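/- arXiv:2508.16229 — 7 statements merged into one kernel-verified Lean document; each statement's English description precedes it below -/
import Mathlib

section
/- The function F₁ is convex on ℝ. -/
/-- The function `F₁` from the decomposition of `s ↦ (1/2) s² log s²`. -/
noncomputable def F1 (δ : ℝ) (s : ℝ) : ℝ :=
  if s = 0 then 0
  else if |s| < δ then -(1/2) * s^2 * Real.log (s^2)
  else -(1/2) * s^2 * (Real.log (δ^2) + 3) + 2*δ*|s| - δ^2/2

open Set Real

/-- The even function `F1 δ` as a function of `t = |s|`. -/
noncomputable def F1Radial (δ t : ℝ) : ℝ :=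
  if t < δ then -(t ^ 2 * log t) else -(1/2) * t^2 * (2 * log δ + 3) + 2*δ*t - δ^2/2

/-- The derivative of `F1Radial δ` on the positive half-line. -/
noncomputable def F1RadialDeriv (δ t : ℝ) : ℝ :=
  if t < δ then -(2 * t * log t + t) else -(t * (2 * log δ + 3)) + 2 * δ

lemma F1_eq_radial_norm {δ : ℝ} (hδ0 : 0 < δ) (s : ℝ) : F1 δ s = F1Radial δ ‖s‖ := by
  unfold F1 F1Radial
  rw [Real.norm_eq_abs, log_pow, log_pow, log_abs, sq_abs]
  by_cases hs : s = 0
  · simp [hs, hδ0]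
  · rw [if_neg hs]
    split_ifs <;> push_cast <;> ring

lemma F1Radial_of_le {δ t : ℝ} (h : t ≤ δ) : F1Radial δ t = -(t ^ 2 * log t) := by
  rcases h.lt_or_eq with h | rfl
  · exact if_pos h
  · rw [F1Radial, if_neg (lt_irrefl _)]; ring

lemma F1RadialDeriv_of_le {δ t : ℝ} (h : t ≤ δ) :
    F1RadialDeriv δ t = -(2 * t * log t + t) := by
  rcases h.lt_or_eq with h | rfl
  · exact if_pos h
  · rw [F1RadialDeriv, if_neg (lt_irrefl _)]; ring

lemma F1Radial_of_ge {δ t : ℝ} (h : δ ≤ t) :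
    F1Radial δ t = -(1/2) * t^2 * (2 * log δ + 3) + 2*δ*t - δ^2/2 :=
  if_neg h.not_gt

lemma F1RadialDeriv_of_ge {δ t : ℝ} (h : δ ≤ t) :
    F1RadialDeriv δ t = -(t * (2 * log δ + 3)) + 2 * δ :=
  if_neg h.not_gt

lemma hasDerivWithinAt_F1Radial_Iic {δ t : ℝ} (ht0 : 0 < t) (ht : t ≤ δ) :
    HasDerivWithinAt (F1Radial δ) (F1RadialDeriv δ t) (Iic δ) t := by
  have h : HasDerivAt (fun t : ℝ => -(t ^ 2 * log t)) (F1RadialDeriv δ t) t := by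
    refine (((hasDerivAt_id t).pow 2).mul (hasDerivAt_log ht0.ne')).neg.congr_deriv ?_
    rw [F1RadialDeriv_of_le ht]
    simp
    field_simp
  exact h.hasDerivWithinAt.congr (fun x hx => F1Radial_of_le hx) (F1Radial_of_le ht)

lemma hasDerivWithinAt_F1Radial_Ici {δ t : ℝ} (ht : δ ≤ t) :
    HasDerivWithinAt (F1Radial δ) (F1RadialDeriv δ t) (Ici δ) t := by
  have h : HasDerivAt (fun t : ℝ => -(1/2) * t^2 * (2 * log δ + 3) + 2*δ*t - δ^2/2)
      (F1RadialDeriv δ t) t := by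
    refine ((((((hasDerivAt_id t).pow 2).const_mul (-(1/2))).mul_const (2 * log δ + 3)).add
      ((hasDerivAt_id t).const_mul (2 * δ))).sub_const (δ^2/2)).congr_deriv ?_
    rw [F1RadialDeriv_of_ge ht]
    simp
  exact h.hasDerivWithinAt.congr (fun x hx => F1Radial_of_ge hx) (F1Radial_of_ge ht)

lemma hasDerivAt_F1Radial {δ t : ℝ} (ht0 : 0 < t) :
    HasDerivAt (F1Radial δ) (F1RadialDeriv δ t) t := by
  rcases lt_trichotomy t δ with h | rfl | h
  · exact (hasDerivWithinAt_F1Radial_Iic ht0 h.le).hasDerivAt (Iic_mem_nhds h)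
  · rw [← hasDerivWithinAt_univ, ← Iic_union_Ici (a := t)]
    exact (hasDerivWithinAt_F1Radial_Iic ht0 le_rfl).union
      (hasDerivWithinAt_F1Radial_Ici le_rfl)
  · exact (hasDerivWithinAt_F1Radial_Ici h.le).hasDerivAt (Ici_mem_nhds h)

lemma continuousOn_F1Radial {δ : ℝ} (hδ0 : 0 < δ) : ContinuousOn (F1Radial δ) (Ici 0) := by
  intro t ht
  rcases (mem_Ici.mp ht).eq_or_lt with rfl | ht
  · have h : Continuous fun t : ℝ => -(t * (t * log t)) :=
      (continuous_id.mul continuous_mul_log).neg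
    refine (h.continuousAt.congr ?_).continuousWithinAt
    filter_upwards [Iic_mem_nhds hδ0] with t ht
    rw [F1Radial_of_le ht]
    ring
  · exact (hasDerivAt_F1Radial ht).continuousAt.continuousWithinAt

lemma monotoneOn_F1RadialDeriv {δ : ℝ} (hδ : 2 * log δ + 3 ≤ 0) :
    MonotoneOn (F1RadialDeriv δ) (Ioi 0) := by
  have hin : ∀ a b, 0 < a → a ≤ b → b ≤ δ → F1RadialDeriv δ a ≤ F1RadialDeriv δ b := by
    intro a b ha hab hb
    have hb0 : 0 < b := ha.trans_le hab
    have hlog : a * (log b - log a) ≤ b - a := by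
      rw [← log_div hb0.ne' ha.ne']
      calc a * log (b / a) ≤ a * (b / a - 1) :=
            mul_le_mul_of_nonneg_left (log_le_sub_one_of_pos (by positivity)) ha.le
        _ = b - a := by field_simp
    have hlb : log b ≤ log δ := log_le_log hb0 hb
    rw [F1RadialDeriv_of_le (hab.trans hb), F1RadialDeriv_of_le hb]
    nlinarith [mul_nonneg (sub_nonneg.mpr hab) (show 0 ≤ -(2 * log b + 3) by linarith)]
  have hout : ∀ a b, δ ≤ a → a ≤ b → F1RadialDeriv δ a ≤ F1RadialDeriv δ b := by
    intro a b ha hab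
    rw [F1RadialDeriv_of_ge ha, F1RadialDeriv_of_ge (ha.trans hab)]
    nlinarith
  intro a ha b _ hab
  rcases le_total b δ with hb | hb
  · exact hin a b ha hab hb
  rcases le_total a δ with haδ | haδ
  · exact (hin a δ ha haδ le_rfl).trans (hout δ b le_rfl hb)
  · exact hout a b haδ hab

lemma F1RadialDeriv_nonneg {δ t : ℝ} (hδ0 : 0 < δ) (hδ : 2 * log δ + 3 ≤ 0) (ht0 : 0 < t) :
    0 ≤ F1RadialDeriv δ t := by
  rcases le_total t δ with ht | ht
  · have := log_le_log ht0 ht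
    rw [F1RadialDeriv_of_le ht]
    nlinarith
  · rw [F1RadialDeriv_of_ge ht]
    nlinarith

lemma convexOn_F1Radial {δ : ℝ} (hδ0 : 0 < δ) (hδ : 2 * log δ + 3 ≤ 0) :
    ConvexOn ℝ (Ici 0) (F1Radial δ) := by
  refine MonotoneOn.convexOn_of_deriv (convex_Ici 0) (continuousOn_F1Radial hδ0) ?_ ?_ <;>
    rw [interior_Ici]
  · exact fun t ht => (hasDerivAt_F1Radial ht).differentiableAt.differentiableWithinAt
  · exact (monotoneOn_F1RadialDeriv hδ).congr fun t ht => (hasDerivAt_F1Radial ht).deriv.symm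

lemma monotoneOn_F1Radial {δ : ℝ} (hδ0 : 0 < δ) (hδ : 2 * log δ + 3 ≤ 0) :
    MonotoneOn (F1Radial δ) (Ici 0) := by
  refine monotoneOn_of_deriv_nonneg (convex_Ici 0) (continuousOn_F1Radial hδ0) ?_ ?_ <;>
    rw [interior_Ici] <;> intro t ht
  · exact (hasDerivAt_F1Radial ht).differentiableAt.differentiableWithinAt
  · rw [(hasDerivAt_F1Radial ht).deriv]
    exact F1RadialDeriv_nonneg hδ0 hδ ht

/-- `F₁` is convex on `ℝ`. -/
theorem F1_convex (δ : ℝ) (hδ0 : 0 < δ) (hδ : δ ≤ Real.exp (-(3/2))) :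
    ConvexOn ℝ Set.univ (F1 δ) := by
  have hlog : 2 * log δ + 3 ≤ 0 := by
    have := (log_le_iff_le_exp hδ0).mpr hδ
    linarith
  have hnorm : (norm : ℝ → ℝ) '' univ = Ici 0 := by
    ext t
    refine ⟨?_, fun ht => ⟨t, mem_univ t, Real.norm_of_nonneg ht⟩⟩
    rintro ⟨s, -, rfl⟩
    exact norm_nonneg s
  rw [show F1 δ = F1Radial δ ∘ norm from funext (F1_eq_radial_norm hδ0)]
  refine ConvexOn.comp ?_ convexOn_univ_norm ?_ <;> rw [hnorm]
  · exact convexOn_F1Radial hδ0 hlog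
  · exact monotoneOn_F1Radial hδ0 hlog
end

section
/- The function F₂ is continuously differentiable on ℝ with F₂'(s) = 0 for |s| ≤ δ and F₂'(s) = s·log(s²/δ²) + 2δ·sgn(s) − 2s for |s| ≥ δ, and for every exponent p with 2 < p < 6/(3 − 2α), where α ∈ (3/4, 1), there exists a constant C > 0 such that |F₂'(s)| ≤ C|s|^{p−1} for all s ∈ ℝ. -/
/-- The function `F₂` from the decomposition of `s ↦ (1/2) s² log s²`. -/
noncomputable def F2 (δ : ℝ) (s : ℝ) : ℝ :=
  if |s| < δ then 0
  else (1/2) * s^2 * Real.log (s^2/δ^2) + 2*δ*|s| - (3/2)*s^2 - δ^2/2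

/-- The derivative of `F₂`. -/
noncomputable def F2' (δ : ℝ) (s : ℝ) : ℝ :=
  if |s| ≤ δ then 0
  else s * Real.log (s^2/δ^2) + 2*δ * Real.sign s - 2*s

/-- The contribution of the positive half-line to `F2`. -/
noncomputable def F2Pos (δ s : ℝ) : ℝ :=
  (max s δ)^2 * Real.log (max s δ / δ) + 2*δ*max s δ - (3/2)*(max s δ)^2 - δ^2/2

/-- The derivative of `F2Pos`. -/
noncomputable def F2Pos' (δ s : ℝ) : ℝ :=
  2 * max s δ * Real.log (max s δ / δ) + 2*δ - 2*max s δ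

theorem F2Pos_of_le {δ s : ℝ} (hδ : 0 < δ) (hs : s ≤ δ) : F2Pos δ s = 0 := by
  simp only [F2Pos, max_eq_right hs, div_self hδ.ne', Real.log_one]
  ring

theorem F2Pos'_of_le {δ s : ℝ} (hδ : 0 < δ) (hs : s ≤ δ) : F2Pos' δ s = 0 := by
  simp only [F2Pos', max_eq_right hs, div_self hδ.ne', Real.log_one]
  ring

theorem log_sq_div_sq (s δ : ℝ) : Real.log (s^2/δ^2) = 2 * Real.log (s/δ) := by
  rw [← div_pow, Real.log_pow]
  norm_num

theorem F2_eq {δ : ℝ} (hδ : 0 < δ) (s : ℝ) : F2 δ s = F2Pos δ s + F2Pos δ (-s) := by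
  unfold F2
  split_ifs with h
  · rw [abs_lt] at h
    rw [F2Pos_of_le hδ h.2.le, F2Pos_of_le hδ (by linarith)]
    ring
  · rcases le_abs.1 (not_lt.1 h) with h | h
    · rw [F2Pos_of_le hδ (by linarith : -s ≤ δ), F2Pos, max_eq_left h,
        abs_of_pos (by linarith), log_sq_div_sq]
      ring
    · rw [F2Pos_of_le hδ (by linarith : s ≤ δ), F2Pos, max_eq_left h,
        abs_of_neg (by linarith), ← neg_sq s, log_sq_div_sq]
      ring

theorem F2'_eq {δ : ℝ} (hδ : 0 < δ) (s : ℝ) : F2' δ s = F2Pos' δ s - F2Pos' δ (-s) := by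
  unfold F2'
  split_ifs with h
  · rw [abs_le] at h
    rw [F2Pos'_of_le hδ h.2, F2Pos'_of_le hδ (by linarith)]
    ring
  · rcases lt_abs.1 (not_le.1 h) with h | h
    · rw [F2Pos'_of_le hδ (by linarith : -s ≤ δ), F2Pos', max_eq_left h.le,
        Real.sign_of_pos (by linarith), log_sq_div_sq]
      ring
    · rw [F2Pos'_of_le hδ (by linarith : s ≤ δ), F2Pos', max_eq_left h.le,
        Real.sign_of_neg (by linarith), ← neg_sq s, log_sq_div_sq]
      ring

theorem hasDerivAt_F2Pos {δ : ℝ} (hδ : 0 < δ) (s : ℝ) :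
    HasDerivAt (F2Pos δ) (F2Pos' δ s) s := by
  have left (hs : s ≤ δ) : HasDerivWithinAt (F2Pos δ) (F2Pos' δ s) (Set.Iic δ) s := by
    rw [F2Pos'_of_le hδ hs]
    exact (hasDerivWithinAt_const s _ 0).congr (fun x hx => F2Pos_of_le hδ hx)
      (F2Pos_of_le hδ hs)
  have right (hs : δ ≤ s) : HasDerivWithinAt (F2Pos δ) (F2Pos' δ s) (Set.Ici δ) s := by
    have hs0 : 0 < s := hδ.trans_le hs
    have hlog : HasDerivAt (fun t : ℝ => Real.log (t / δ)) (1 / δ / (s / δ)) s :=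
      ((hasDerivAt_id s).div_const δ).log (div_pos hs0 hδ).ne'
    have key : HasDerivAt
        (fun t : ℝ => t^2 * Real.log (t / δ) + 2*δ*t - (3/2)*t^2 - δ^2/2) (F2Pos' δ s) s := by
      have := ((((hasDerivAt_pow 2 s).mul hlog).add
        ((hasDerivAt_id s).const_mul (2*δ))).sub
        ((hasDerivAt_pow 2 s).const_mul (3/2))).sub_const (δ^2/2)
      refine this.congr_deriv ?_
      rw [F2Pos', max_eq_left hs]
      field_simp
      norm_num
      ring
    have heq (x : ℝ) (hx : δ ≤ x) :
        F2Pos δ x = x^2 * Real.log (x / δ) + 2*δ*x - (3/2)*x^2 - δ^2/2 := by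
      rw [F2Pos, max_eq_left hx]
    exact key.hasDerivWithinAt.congr (fun x hx => heq x hx) (heq s hs)
  rcases lt_trichotomy s δ with hs | rfl | hs
  · exact (left hs.le).hasDerivAt (Iic_mem_nhds hs)
  · simpa [Set.Iic_union_Ici] using (left le_rfl).union (right le_rfl)
  · exact (right hs.le).hasDerivAt (Ici_mem_nhds hs)

theorem continuous_F2Pos' {δ : ℝ} (hδ : 0 < δ) : Continuous (F2Pos' δ) := by
  have hlog : Continuous fun s : ℝ => Real.log (max s δ / δ) :=
    Continuous.log (by fun_prop) fun s =>
      (div_pos (hδ.trans_le (le_max_right s δ)) hδ).ne'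
  unfold F2Pos'
  fun_prop

theorem abs_F2Pos'_le {δ p : ℝ} (hδ : 0 < δ) (hp : 2 < p) (s : ℝ) :
    |F2Pos' δ s| ≤ (2 / (p - 2) + 4) / δ ^ (p - 2) * |s| ^ (p - 1) := by
  have hp' : 0 < p - 2 := by linarith
  rcases le_total s δ with hs | hs
  · rw [F2Pos'_of_le hδ hs, abs_zero]
    positivity
  have hs0 : 0 < s := hδ.trans_le hs
  have h1 : 1 ≤ s / δ := (one_le_div hδ).2 hs
  have hlog0 : 0 ≤ Real.log (s / δ) := Real.log_nonneg h1
  have hlog := Real.log_le_rpow_div (zero_le_one.trans h1) hp'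
  have hone : 1 ≤ (s / δ) ^ (p - 2) := Real.one_le_rpow h1 hp'.le
  have hpow : s ^ (p - 1) = s * s ^ (p - 2) := by
    rw [← Real.rpow_one_add' hs0.le (by linarith)]
    ring_nf
  calc |F2Pos' δ s| ≤ 2 * s * Real.log (s / δ) + 4 * s * 1 := by
        rw [F2Pos', max_eq_left hs, abs_le]
        have := mul_nonneg hs0.le hlog0
        constructor <;> linarith
    _ ≤ 2 * s * ((s / δ) ^ (p - 2) / (p - 2)) + 4 * s * (s / δ) ^ (p - 2) := by gcongr
    _ = (2 / (p - 2) + 4) / δ ^ (p - 2) * |s| ^ (p - 1) := by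
        rw [abs_of_pos hs0, hpow, Real.div_rpow hs0.le hδ.le]
        ring

/-- `F₂` is continuously differentiable with the stated derivative, and for every
`p ∈ (2, 6/(3-2α))` with `α ∈ (3/4, 1)` there is `C > 0` with `|F₂'(s)| ≤ C |s|^(p-1)`. -/
theorem F2_contDiff_and_growth (δ α : ℝ) (hδ0 : 0 < δ) (hδ : δ ≤ Real.exp (-(3/2)))
    (hα1 : 3/4 < α) (hα2 : α < 1) :
    (∀ s : ℝ, HasDerivAt (F2 δ) (F2' δ s) s) ∧ Continuous (F2' δ) ∧
    ∀ p : ℝ, 2 < p → p < 6 / (3 - 2*α) →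
      ∃ C : ℝ, 0 < C ∧ ∀ s : ℝ, |F2' δ s| ≤ C * |s| ^ (p - 1) := by
  refine ⟨fun s => ?_, ?_, fun p hp _ => ?_⟩
  · rw [F2'_eq hδ0, funext (F2_eq hδ0)]
    have hneg : HasDerivAt (fun t => F2Pos δ (-t)) (-F2Pos' δ (-s)) s := by
      exact ((hasDerivAt_F2Pos hδ0 (-s)).comp s (hasDerivAt_neg s)).congr_deriv (by ring)
    exact (hasDerivAt_F2Pos hδ0 s).add hneg
  · rw [funext (F2'_eq hδ0)]
    have := continuous_F2Pos' hδ0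
    fun_prop
  · have hp' : 0 < p - 2 := by linarith
    refine ⟨2 * ((2 / (p - 2) + 4) / δ ^ (p - 2)), by positivity, fun s => ?_⟩
    have h1 := abs_F2Pos'_le hδ0 hp s
    have h2 := abs_F2Pos'_le hδ0 hp (-s)
    rw [abs_neg] at h2
    rw [F2'_eq hδ0]
    linarith [abs_sub (F2Pos' δ s) (F2Pos' δ (-s))]
end

section
/- The map s ↦ F₂'(s)/s is nondecreasing on (0, ∞) and strictly increasing on (δ, ∞). -/
/-- For `s > δ > 0` the quotient `F₂'(s)/s` is `log (s²/δ²) + 2δ/s - 2`. -/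
lemma F2'_div_self_of_lt {δ s : ℝ} (hδ : 0 < δ) (hs : δ < s) :
    F2' δ s / s = Real.log (s^2/δ^2) + 2*δ/s - 2 := by
  have hs0 : 0 < s := hδ.trans hs
  rw [F2', abs_of_pos hs0, if_neg hs.not_ge, Real.sign_of_pos hs0]
  field_simp

lemma F2'_div_self_of_le {δ s : ℝ} (hs0 : 0 < s) (hs : s ≤ δ) : F2' δ s / s = 0 := by
  rw [F2', abs_of_pos hs0, if_pos hs, zero_div]

lemma strictMonoOn_log_sq_div_add_two_mul_div {δ : ℝ} (hδ : 0 < δ) :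
    StrictMonoOn (fun s : ℝ => Real.log (s^2/δ^2) + 2*δ/s - 2) (Set.Ici δ) := by
  intro a ha b _ hab
  have ha' : δ ≤ a := ha
  have ha0 : 0 < a := hδ.trans_le ha'
  have hb0 : 0 < b := ha0.trans hab
  have hlog : Real.log (a/b) < a/b - 1 :=
    Real.log_lt_sub_one_of_pos (div_pos ha0 hb0) ((div_lt_one hb0).2 hab).ne
  rw [Real.log_div ha0.ne' hb0.ne'] at hlog
  have hdiv : 2*δ/a - 2*δ/b ≤ 2 * (1 - a/b) := by
    have h : 2 * (1 - a/b) - (2*δ/a - 2*δ/b) = 2 * ((a - δ) * (b - a) / (a*b)) := by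
      field_simp
    have : 0 ≤ (a - δ) * (b - a) / (a*b) :=
      div_nonneg (mul_nonneg (sub_nonneg.2 ha') (sub_nonneg.2 hab.le)) (mul_pos ha0 hb0).le
    linarith
  simp only [Real.log_div (pow_pos ha0 2).ne' (pow_pos hδ 2).ne',
    Real.log_div (pow_pos hb0 2).ne' (pow_pos hδ 2).ne', Real.log_pow]
  push_cast
  linarith

/-- `s ↦ F₂'(s)/s` is nondecreasing on `(0, ∞)` and strictly increasing on `(δ, ∞)`. -/
theorem F2_quotient_monotone (δ : ℝ) (hδ0 : 0 < δ) (hδ : δ ≤ Real.exp (-(3/2))) :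
    MonotoneOn (fun s : ℝ => F2' δ s / s) (Set.Ioi (0 : ℝ)) ∧
    StrictMonoOn (fun s : ℝ => F2' δ s / s) (Set.Ioi δ) := by
  have hmono := strictMonoOn_log_sq_div_add_two_mul_div hδ0
  have hstrict : StrictMonoOn (fun s : ℝ => F2' δ s / s) (Set.Ioi δ) :=
    (hmono.mono Set.Ioi_subset_Ici_self).congr fun s hs => (F2'_div_self_of_lt hδ0 hs).symm
  refine ⟨fun a ha b hb hab => ?_, hstrict⟩
  rcases lt_or_ge δ a with hδa | haδ
  · exact hstrict.monotoneOn hδa (hδa.trans_le hab) hab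
  · dsimp only
    rw [F2'_div_self_of_le ha haδ]
    rcases lt_or_ge δ b with hδb | hbδ
    · have h := hmono Set.self_mem_Ici hδb.le hδb
      dsimp only at h
      rw [div_self (pow_pos hδ0 2).ne', Real.log_one, mul_div_cancel_right₀ _ hδ0.ne'] at h
      rw [F2'_div_self_of_lt hδ0 hδb]
      linarith
    · rw [F2'_div_self_of_le hb hbδ]
end

section
/- For every b₀ > 0 there exists a unique a₀ > δ such that F₂'(a₀) = b₀·a₀, i.e. F₂'(a₀)/a₀ = b₀. -/
/-- The slope function `t ↦ 2 log t + 2 / t - 2`, which is `F₂'(s) / s` at `s = δ t`, is strictly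
increasing on `[1, ∞)`. -/
theorem strictMonoOn_two_mul_log_add_two_div :
    StrictMonoOn (fun t : ℝ => 2 * Real.log t + 2 / t - 2) (Set.Ici 1) := by
  intro s hs t _ hst
  have hs1 : (1 : ℝ) ≤ s := hs
  have hs0 : 0 < s := by linarith
  have ht0 : 0 < t := hs0.trans hst
  have hlog : Real.log (s / t) < s / t - 1 :=
    Real.log_lt_sub_one_of_pos (by positivity) ((div_lt_one ht0).2 hst).ne
  rw [Real.log_div hs0.ne' ht0.ne'] at hlog
  have hinv : 1 / s - 1 / t ≤ 1 - s / t := by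
    have h : 1 - s / t - (1 / s - 1 / t) = (t - s) * (s - 1) / (s * t) := by
      field_simp
    have h' : 0 ≤ (t - s) * (s - 1) / (s * t) :=
      div_nonneg (mul_nonneg (by linarith) (by linarith)) (by positivity)
    linarith
  have e1 : 2 / s = 2 * (1 / s) := by ring
  have e2 : 2 / t = 2 * (1 / t) := by ring
  simp only [e1, e2]
  linarith

/-- Every positive value is attained by the slope function at some `t > 1`. -/
theorem exists_two_mul_log_add_two_div_eq {b : ℝ} (hb : 0 < b) :
    ∃ t : ℝ, 1 < t ∧ 2 * Real.log t + 2 / t - 2 = b := by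
  have hT : (1 : ℝ) ≤ Real.exp (b / 2 + 1) := Real.one_le_exp (by linarith)
  have hcont : ContinuousOn (fun t : ℝ => 2 * Real.log t + 2 / t - 2)
      (Set.Icc 1 (Real.exp (b / 2 + 1))) := by
    have hne : ∀ t ∈ Set.Icc (1 : ℝ) (Real.exp (b / 2 + 1)), t ≠ 0 :=
      fun t ht => (zero_lt_one.trans_le ht.1).ne'
    exact ((continuousOn_const.mul (continuousOn_id.log hne)).add
      (continuousOn_const.div continuousOn_id hne)).sub continuousOn_const
  have hpos : 0 < 2 / Real.exp (b / 2 + 1) := by positivity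
  obtain ⟨t, ht, hteq⟩ := intermediate_value_Ioo hT hcont (show b ∈ Set.Ioo _ _ by
    simp only [Set.mem_Ioo, Real.log_one, Real.log_exp]
    constructor <;> linarith)
  exact ⟨t, ht.1, hteq⟩

/-- Above the threshold `δ`, `F₂'(δ t)` is `δ t` times the slope function at `t`. -/
theorem F2'_mul_eq {δ t : ℝ} (hδ : 0 < δ) (ht : 1 < t) :
    F2' δ (δ * t) = (2 * Real.log t + 2 / t - 2) * (δ * t) := by
  have ht0 : 0 < t := zero_lt_one.trans ht
  have hpos : 0 < δ * t := mul_pos hδ ht0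
  have hlt : ¬ |δ * t| ≤ δ := by
    rw [abs_of_pos hpos, not_le]
    exact lt_mul_of_one_lt_right hδ ht
  have hsq : (δ * t) ^ 2 / δ ^ 2 = t ^ 2 := by field_simp
  rw [F2', if_neg hlt, Real.sign_of_pos hpos, hsq, Real.log_pow]
  push_cast
  field_simp

/-- For every `b₀ > 0` there is a unique `a₀ > δ` with `F₂'(a₀) = b₀ a₀`. -/
theorem F2_unique_a0 (δ : ℝ) (hδ0 : 0 < δ) (hδ : δ ≤ Real.exp (-(3/2)))
    (b0 : ℝ) (hb0 : 0 < b0) :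
    ∃! a0 : ℝ, δ < a0 ∧ F2' δ a0 = b0 * a0 := by
  obtain ⟨t, ht1, ht⟩ := exists_two_mul_log_add_two_div_eq hb0
  refine ⟨δ * t, ⟨lt_mul_of_one_lt_right hδ0 ht1, by rw [F2'_mul_eq hδ0 ht1, ht]⟩, ?_⟩
  rintro a ⟨ha, heq⟩
  obtain ⟨u, rfl⟩ : ∃ u, a = δ * u := ⟨a / δ, by field_simp⟩
  have hu1 : 1 < u := (lt_mul_iff_one_lt_right hδ0).1 ha
  rw [F2'_mul_eq hδ0 hu1] at heq
  have hu := mul_right_cancel₀ (hδ0.trans ha).ne' heq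
  rw [strictMonoOn_two_mul_log_add_two_div.injOn hu1.le ht1.le (hu.trans ht.symm)]
end

section
/- Let b₀ > 0 and let a₀ > δ satisfy F₂'(a₀) = b₀·a₀. Define F̄₂' : [0, ∞) → ℝ by F̄₂'(t) = F₂'(t) for 0 ≤ t ≤ a₀ and F̄₂'(t) = b₀·t for t ≥ a₀. Then F̄₂'(t) ≤ b₀·t for every t ≥ 0; in particular F₂'(t) ≤ b₀·t for all t ∈ [0, a₀]. -/
/-- The truncated derivative `F̄₂'`: it agrees with `F₂'` on `[0, a₀]` and equals
`b₀ t` for `t ≥ a₀`. -/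
noncomputable def F2barDeriv (δ b0 a0 : ℝ) (t : ℝ) : ℝ :=
  if t ≤ a0 then F2' δ t else b0 * t

theorem F2'_of_lt {δ s : ℝ} (hδ : 0 < δ) (hs : δ < s) :
    F2' δ s = s * Real.log (s^2/δ^2) + 2*δ - 2*s := by
  have hs0 : 0 < s := hδ.trans hs
  rw [F2', abs_of_pos hs0, if_neg hs.not_ge, Real.sign_of_pos hs0, mul_one]

/-- The quotient `F₂'(t) / t` is nondecreasing on `(δ, ∞)`, with denominators cleared. -/
theorem mul_F2'_le_mul_F2' {δ t a : ℝ} (hδ : 0 < δ) (ht : δ < t) (hta : t ≤ a) :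
    a * F2' δ t ≤ t * F2' δ a := by
  have ht0 : 0 < t := hδ.trans ht
  have ha0 : 0 < a := ht0.trans_le hta
  rw [F2'_of_lt hδ ht, F2'_of_lt hδ (ht.trans_le hta)]
  have hlog : Real.log (t^2/δ^2) = Real.log (a^2/δ^2) + 2 * Real.log (t/a) := by
    rw [Real.log_div (by positivity) (by positivity), Real.log_div (by positivity) (by positivity),
      Real.log_div ht0.ne' ha0.ne', Real.log_pow, Real.log_pow, Real.log_pow]
    push_cast
    ring
  have hbound : a * Real.log (t/a) ≤ t - a := by
    calc a * Real.log (t/a) ≤ a * (t/a - 1) := by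
          gcongr
          exact Real.log_le_sub_one_of_pos (by positivity)
      _ = t - a := by field_simp
  rw [hlog]
  nlinarith [mul_le_mul_of_nonneg_left hbound ht0.le,
    mul_nonneg (sub_nonneg.2 ht.le) (sub_nonneg.2 hta)]

/-- If `a₀ > δ` satisfies `F₂'(a₀) = b₀ a₀`, then `F̄₂'(t) ≤ b₀ t` for all `t ≥ 0`;
in particular `F₂'(t) ≤ b₀ t` on `[0, a₀]`. -/
theorem F2bar_le (δ b0 a0 : ℝ) (hδ0 : 0 < δ) (hδ : δ ≤ Real.exp (-(3/2)))
    (hb0 : 0 < b0) (ha0 : δ < a0) (heq : F2' δ a0 = b0 * a0) :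
    (∀ t : ℝ, 0 ≤ t → F2barDeriv δ b0 a0 t ≤ b0 * t) ∧
    (∀ t : ℝ, 0 ≤ t → t ≤ a0 → F2' δ t ≤ b0 * t) := by
  have hF2' : ∀ t : ℝ, 0 ≤ t → t ≤ a0 → F2' δ t ≤ b0 * t := by
    intro t ht hta
    rcases le_or_gt t δ with h | h
    · rw [F2', abs_of_nonneg ht, if_pos h]
      positivity
    · have hmono := mul_F2'_le_mul_F2' hδ0 h hta
      rw [heq] at hmono
      exact le_of_mul_le_mul_left (by linarith) (hδ0.trans ha0)
  refine ⟨fun t ht => ?_, hF2'⟩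
  rw [F2barDeriv]
  split_ifs with h
  · exact hF2' t ht h
  · exact le_rfl
end

section
/- For every real number t one has (1/2)·F₁(t) ≥ (1/4)·t² + (1/2)·F₂(t) − (1/4)·F₂'(t)·t. -/
/-- For every `t`, `(1/2) F₁(t) ≥ (1/4) t² + (1/2) F₂(t) − (1/4) F₂'(t) t`. -/
theorem half_F1_ge (δ : ℝ) (hδ0 : 0 < δ) (hδ : δ ≤ Real.exp (-(3/2))) :
    ∀ t : ℝ, (1/4) * t^2 + (1/2) * F2 δ t - (1/4) * F2' δ t * t ≤ (1/2) * F1 δ t := by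
  intro t
  have log_sq_le {s : ℝ} (hs : 0 < s) (hsδ : s ≤ δ) : Real.log (s^2) ≤ -3 := by
    have h := (Real.log_le_iff_le_exp hs).2 (hsδ.trans hδ)
    rw [Real.log_pow]
    push_cast
    linarith
  have hlogδ := log_sq_le hδ0 le_rfl
  have hmul : 0 ≤ t^2 * (-3 - Real.log (δ^2)) :=
    mul_nonneg (sq_nonneg t) (by linarith)
  rcases eq_or_ne t 0 with rfl | ht
  · simp [F1, F2, hδ0]
  rcases lt_trichotomy |t| δ with h | h | h
  · have hlogt := log_sq_le (abs_pos.2 ht) h.le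
    rw [sq_abs] at hlogt
    simp only [F1, F2, F2', ht, h, h.le, if_true, if_false]
    nlinarith [sq_nonneg t]
  · have hsq : t^2 = δ^2 := by rw [← sq_abs, h]
    have hδ2 : 0 < δ^2 := by positivity
    rw [hsq] at hmul
    simp only [F1, F2, F2', ht, h, hsq, div_self hδ2.ne', Real.log_one, lt_irrefl, le_refl,
      if_true, if_false]
    nlinarith
  · have hsign : Real.sign t * t = |t| := by
      rcases ht.lt_or_gt with ht | ht
      · rw [Real.sign_of_neg ht, abs_of_neg ht]; ring
      · rw [Real.sign_of_pos ht, abs_of_pos ht]; ring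
    have hδt : 0 < δ * |t| := mul_pos hδ0 (abs_pos.2 ht)
    simp only [F1, F2, F2', ht, h.not_gt, h.not_ge, if_false]
    linear_combination (1/4) * hmul + (1/2) * hδt - (1/2) * δ * hsign
end

section
/- The map s ↦ F₁'(s)/s³ is strictly decreasing on (0, ∞). -/
/-- The derivative of `F₁`. -/
noncomputable def F1' (δ : ℝ) (s : ℝ) : ℝ :=
  if s = 0 then 0
  else if |s| < δ then -(Real.log (s^2) + 1) * s
  else -(Real.log (δ^2) + 3) * s + 2*δ * Real.sign s

theorem F1'_div_cube_of_le {δ s : ℝ} (hs : 0 < s) (h : s ≤ δ) :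
    F1' δ s / s ^ 3 = -(2 * Real.log s + 1) / s ^ 2 := by
  rcases h.lt_or_eq with h | rfl
  · simp only [F1', hs.ne', if_false, abs_of_pos hs, h, if_true, Real.log_pow]
    push_cast
    field_simp
  · simp only [F1', hs.ne', if_false, abs_of_pos hs, lt_irrefl, Real.log_pow,
      Real.sign_of_pos hs]
    push_cast
    field_simp
    ring

theorem F1'_div_cube_of_ge {δ s : ℝ} (hs : 0 < s) (h : δ ≤ s) :
    F1' δ s / s ^ 3 = -(2 * Real.log δ + 3) / s ^ 2 + 2 * δ / s ^ 3 := by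
  simp only [F1', hs.ne', if_false, abs_of_pos hs, h.not_gt, Real.log_pow,
    Real.sign_of_pos hs]
  push_cast
  field_simp

/-- `s ↦ F₁'(s)/s³` is strictly decreasing on `(0, ∞)`. -/
theorem F1_quotient_strictAnti (δ : ℝ) (hδ0 : 0 < δ) (hδ : δ ≤ Real.exp (-(3/2))) :
    StrictAntiOn (fun s : ℝ => F1' δ s / s^3) (Set.Ioi (0 : ℝ)) := by
  have hL : Real.log δ ≤ -(3/2) := (Real.log_le_iff_le_exp hδ0).2 hδ
  rw [← Set.Ioc_union_Ici_eq_Ioi hδ0]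
  refine StrictAntiOn.union ?_ ?_ (isGreatest_Ioc hδ0) isLeast_Ici
  · rintro s ⟨hs, hsδ⟩ t ⟨ht, htδ⟩ hst
    simp only [F1'_div_cube_of_le hs hsδ, F1'_div_cube_of_le ht htδ]
    have hlog := Real.log_lt_log hs hst
    have hlogδ := Real.log_le_log hs hsδ
    exact div_lt_div₀ (by linarith) (by gcongr) (by linarith) (by positivity)
  · intro s hs t ht hst
    rw [Set.mem_Ici] at hs ht
    have hs0 : 0 < s := hδ0.trans_le hs
    simp only [F1'_div_cube_of_ge hs0 hs, F1'_div_cube_of_ge (hs0.trans hst) ht]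
    have hA : 0 ≤ -(2 * Real.log δ + 3) := by linarith
    exact add_lt_add_of_le_of_lt (by gcongr) (by gcongr)
end
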